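/- arXiv:1807.04603 — 15 statements merged into one kernel-verified Lean document; each statement's English description precedes it below -/
import Mathlib

section
/- For every compilation chain, Robust Trace Property Preservation (RTP) holds if and only if its property-free characterization (pfRTP) holds, where RTP states: for every trace property π (a set of traces) and every source program P, if for all source contexts Cs and traces t, Cs[P] ⇝ t implies t ∈ π, then for all target contexts Ct and traces t, Ct[P↓] ⇝ t implies t ∈ π; and pfRTP states: for every source program P, target context Ct, and trace t, if Ct[P↓] ⇝ t then there exists a source context Cs such that Cs[P] ⇝ t. -/
/-- RTP ↔ pfRTP for every compilation chain. -/
theorem rtp_iff_pfrtp {Prog CtxS CtxT Trace : Type}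
    (semS : CtxS → Prog → Trace → Prop)
    (semT : CtxT → Prog → Trace → Prop) :
    -- RTP
    (∀ (π : Set Trace) (P : Prog),
        (∀ (Cs : CtxS) (t : Trace), semS Cs P t → t ∈ π) →
        (∀ (Ct : CtxT) (t : Trace), semT Ct P t → t ∈ π))
    ↔
    -- pfRTP
    (∀ (P : Prog) (Ct : CtxT) (t : Trace),
        semT Ct P t → ∃ Cs : CtxS, semS Cs P t) := by
  constructor
  · intro h P Ct t ht
    exact h {t | ∃ Cs, semS Cs P t} P (fun Cs _ hs => ⟨Cs, hs⟩) Ct t ht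
  · intro h π P hπ Ct t ht
    obtain ⟨Cs, hs⟩ := h P Ct t ht
    exact hπ Cs t hs
end

section
/- For every compilation chain over the concrete trace model, Robust Safety Property Preservation (RSP) holds if and only if its property-free characterization (pfRSP) holds, where RSP states: for every safety property π and every source program P, if for all source contexts Cs and traces t, Cs[P] ⇝ t implies t ∈ π, then for all target contexts Ct and traces t, Ct[P↓] ⇝ t implies t ∈ π; and pfRSP states: for every source program P, target context Ct, and finite prefix m, if Ct[P↓] ⇝ m then there exists a source context Cs such that Cs[P] ⇝ m. -/
/-- Concrete trace model: a trace is either a terminated trace (finite list of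
events) or an infinite stream of events. -/
inductive Trc (E : Type) : Type where
  | term : List E → Trc E
  | inf  : (Nat → E) → Trc E

/-- Finite prefixes: incomplete or complete, in both cases a finite list of events. -/
inductive Pref (E : Type) : Type where
  | incomplete : List E → Pref E
  | complete   : List E → Pref E

/-- The prefix relation m ≤ t. -/
def prefOf {E : Type} : Pref E → Trc E → Prop
  | Pref.incomplete l, Trc.term l' => l <+: l'
  | Pref.incomplete l, Trc.inf s  => l = (List.range l.length).map s
  | Pref.complete l,  Trc.term l' => l' = l
  | Pref.complete _,  Trc.inf _   => False

/-- π is a safety property. -/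
def Safety {E : Type} (π : Set (Trc E)) : Prop :=
  ∀ t, t ∉ π → ∃ m : Pref E, prefOf m t ∧ ∀ t', prefOf m t' → t' ∉ π

/-- RSP ↔ pfRSP for every compilation chain over the concrete
trace model. -/
theorem rsp_iff_pfrsp {E Prog CtxS CtxT : Type}
    (semS : CtxS → Prog → Trc E → Prop)
    (semT : CtxT → Prog → Trc E → Prop) :
    -- RSP
    (∀ (π : Set (Trc E)), Safety π → ∀ (P : Prog),
        (∀ (Cs : CtxS) (t : Trc E), semS Cs P t → t ∈ π) →
        (∀ (Ct : CtxT) (t : Trc E), semT Ct P t → t ∈ π))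
    ↔
    -- pfRSP
    (∀ (P : Prog) (Ct : CtxT) (m : Pref E),
        (∃ t : Trc E, prefOf m t ∧ semT Ct P t) →
        ∃ Cs : CtxS, ∃ t : Trc E, prefOf m t ∧ semS Cs P t) := by
  constructor
  · intro rsp P Ct m ⟨t, hmt, ht⟩
    by_contra hno
    refine rsp {t | ¬ prefOf m t} (fun u hu => ⟨m, not_not.mp hu, fun _ h hn => hn h⟩) P
      (fun Cs u hu hmu => hno ⟨Cs, u, hmu, hu⟩) Ct t ht hmt
  · intro pf π hπ P hS Ct t ht
    by_contra hno
    obtain ⟨m, hmt, hm⟩ := hπ t hno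
    obtain ⟨Cs, u, hmu, hu⟩ := pf P Ct m ⟨t, hmt, ht⟩
    exact hm u hmu (hS Cs u hu)
end

section
/- (Theorem 2.1) Every compilation chain over the concrete trace model that satisfies RTP also satisfies RSP; but the converse fails: there exists a compilation chain over the concrete trace model (i.e., there exist a nonempty event type E, types of source partial programs, source contexts and target contexts, and source and target semantics over traces built from E) that satisfies RSP but does not satisfy RTP. -/
/-- Robust Trace Property Preservation. -/
def RTP {E Prog CtxS CtxT : Type}
    (semS : CtxS → Prog → Trc E → Prop)
    (semT : CtxT → Prog → Trc E → Prop) : Prop :=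
  ∀ (π : Set (Trc E)) (P : Prog),
    (∀ (Cs : CtxS) (t : Trc E), semS Cs P t → t ∈ π) →
    (∀ (Ct : CtxT) (t : Trc E), semT Ct P t → t ∈ π)

/-- Robust Safety Property Preservation. -/
def RSP {E Prog CtxS CtxT : Type}
    (semS : CtxS → Prog → Trc E → Prop)
    (semT : CtxT → Prog → Trc E → Prop) : Prop :=
  ∀ (π : Set (Trc E)), Safety π → ∀ (P : Prog),
    (∀ (Cs : CtxS) (t : Trc E), semS Cs P t → t ∈ π) →
    (∀ (Ct : CtxT) (t : Trc E), semT Ct P t → t ∈ π)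

theorem RTP.rsp {E Prog CtxS CtxT : Type} {semS : CtxS → Prog → Trc E → Prop}
    {semT : CtxT → Prog → Trc E → Prop} (h : RTP semS semT) : RSP semS semT :=
  fun π _ => h π

/-- Every finite prefix of a trace is a prefix of some terminated trace. -/
theorem exists_prefOf_term {E : Type} {m : Pref E} {t : Trc E} (h : prefOf m t) :
    ∃ l : List E, prefOf m (Trc.term l) := by
  cases m with
  | incomplete l => exact ⟨l, List.prefix_rfl⟩
  | complete l => exact ⟨l, rfl⟩

/-- A safety property containing all terminated traces contains every trace. -/
theorem Safety.mem_of_forall_term_mem {E : Type} {π : Set (Trc E)} (hπ : Safety π)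
    (h : ∀ l : List E, Trc.term l ∈ π) (t : Trc E) : t ∈ π := by
  by_contra ht
  obtain ⟨m, hm, hbad⟩ := hπ t ht
  obtain ⟨l, hl⟩ := exists_prefOf_term hm
  exact hbad _ hl (h l)

/-- Theorem 2.1: RTP ⇒ RSP, but RSP does not imply RTP. -/
theorem rtp_implies_rsp_but_not_conversely :
    (∀ (E Prog CtxS CtxT : Type)
       (semS : CtxS → Prog → Trc E → Prop)
       (semT : CtxT → Prog → Trc E → Prop),
       RTP semS semT → RSP semS semT)
    ∧
    (∃ (E : Type) (_ : Nonempty E) (Prog CtxS CtxT : Type)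
       (semS : CtxS → Prog → Trc E → Prop)
       (semT : CtxT → Prog → Trc E → Prop),
       RSP semS semT ∧ ¬ RTP semS semT) := by
  refine ⟨fun _ _ _ _ _ _ h => h.rsp, Unit, inferInstance, Unit, Unit, Unit,
    fun _ _ t => t ∈ Set.range Trc.term, fun _ _ _ => True, ?_, ?_⟩
  · intro π hπ _ hS _ t _
    exact hπ.mem_of_forall_term_mem (fun l => hS () _ ⟨l, rfl⟩) t
  · intro h
    obtain ⟨l, hl⟩ := h (Set.range Trc.term) () (fun _ _ ht => ht) () (Trc.inf fun _ => ()) trivial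
    cases hl
end

section
/- For every compilation chain, Robust Hyperproperty Preservation (RHP) holds if and only if its property-free characterization (pfRHP) holds, where RHP states: for every hyperproperty H (a set of sets of traces) and every source program P, if for all source contexts Cs, behav(Cs[P]) ∈ H, then for all target contexts Ct, behav(Ct[P↓]) ∈ H; and pfRHP states: for every source program P and target context Ct there exists a source context Cs such that behav(Ct[P↓]) = behav(Cs[P]). -/
/-- RHP ↔ pfRHP for every compilation chain,
where behav(C[P]) = { t | C[P] ⇝ t }. -/
theorem rhp_iff_pfrhp {Prog CtxS CtxT Trace : Type}
    (semS : CtxS → Prog → Trace → Prop)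
    (semT : CtxT → Prog → Trace → Prop) :
    -- RHP
    (∀ (H : Set (Set Trace)) (P : Prog),
        (∀ Cs : CtxS, {t | semS Cs P t} ∈ H) →
        (∀ Ct : CtxT, {t | semT Ct P t} ∈ H))
    ↔
    -- pfRHP
    (∀ (P : Prog) (Ct : CtxT), ∃ Cs : CtxS,
        {t | semT Ct P t} = {t | semS Cs P t}) := by
  constructor
  · intro h P Ct
    exact h {b | ∃ Cs : CtxS, b = {t | semS Cs P t}} P (fun Cs => ⟨Cs, rfl⟩) Ct
  · intro h H P hS Ct
    obtain ⟨Cs, hCs⟩ := h P Ct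
    rw [hCs]
    exact hS Cs
end

section
/- For every compilation chain, Robust Subset-Closed Hyperproperty Preservation (RSCHP) holds if and only if its property-free characterization (pfRSCHP) holds, where RSCHP is RHP restricted to subset-closed hyperproperties, i.e.: for every subset-closed hyperproperty H and every source program P, if for all source contexts Cs, behav(Cs[P]) ∈ H, then for all target contexts Ct, behav(Ct[P↓]) ∈ H; and pfRSCHP states: for every source program P and target context Ct there exists a source context Cs such that for every trace t, Ct[P↓] ⇝ t implies Cs[P] ⇝ t. -/
/-- A hyperproperty is subset-closed. -/
def SubsetClosed {Trace : Type} (H : Set (Set Trace)) : Prop :=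
  ∀ b1 b2 : Set Trace, b1 ⊆ b2 → b2 ∈ H → b1 ∈ H

/-- RSCHP ↔ pfRSCHP for every compilation chain,
where behav(C[P]) = { t | C[P] ⇝ t }. -/
theorem rschp_iff_pfrschp {Prog CtxS CtxT Trace : Type}
    (semS : CtxS → Prog → Trace → Prop)
    (semT : CtxT → Prog → Trace → Prop) :
    -- RSCHP
    (∀ (H : Set (Set Trace)), SubsetClosed H → ∀ (P : Prog),
        (∀ Cs : CtxS, {t | semS Cs P t} ∈ H) →
        (∀ Ct : CtxT, {t | semT Ct P t} ∈ H))
    ↔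
    -- pfRSCHP
    (∀ (P : Prog) (Ct : CtxT), ∃ Cs : CtxS,
        ∀ t : Trace, semT Ct P t → semS Cs P t) := by
  constructor
  · intro h P Ct
    exact h {b | ∃ Cs, b ⊆ {t | semS Cs P t}}
      (fun _ _ hb ⟨Cs, hCs⟩ => ⟨Cs, hb.trans hCs⟩) P (fun Cs => ⟨Cs, subset_rfl⟩) Ct
  · intro h H hH P hS Ct
    obtain ⟨Cs, hCs⟩ := h P Ct
    exact hH _ _ hCs (hS Cs)
end

section
/- For every compilation chain over the concrete trace model, Robust Hypersafety Preservation (RHSP) holds if and only if its property-free characterization (pfRHSP) holds, where RHSP is RHP restricted to hypersafety hyperproperties, i.e.: for every hypersafety hyperproperty H and every source program P, if for all source contexts Cs, behav(Cs[P]) ∈ H, then for all target contexts Ct, behav(Ct[P↓]) ∈ H; and pfRHSP states: for every source program P, target context Ct, and observation o, if o ≤ behav(Ct[P↓]) then there exists a source context Cs such that o ≤ behav(Cs[P]). -/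
/-- An observation (finite set of finite prefixes) is a prefix of a behavior. -/
def obsLe {E : Type} (o : Finset (Pref E)) (b : Set (Trc E)) : Prop :=
  ∀ m ∈ o, ∃ t ∈ b, prefOf m t

/-- H is hypersafety. -/
def Hypersafety {E : Type} (H : Set (Set (Trc E))) : Prop :=
  ∀ b, b ∉ H → ∃ o : Finset (Pref E), obsLe o b ∧ ∀ b', obsLe o b' → b' ∉ H

/-- RHSP ↔ pfRHSP for every compilation chain over the concrete
trace model, where behav(C[P]) = { t | C[P] ⇝ t }. -/
theorem rhsp_iff_pfrhsp {E Prog CtxS CtxT : Type}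
    (semS : CtxS → Prog → Trc E → Prop)
    (semT : CtxT → Prog → Trc E → Prop) :
    -- RHSP
    (∀ (H : Set (Set (Trc E))), Hypersafety H → ∀ (P : Prog),
        (∀ Cs : CtxS, {t | semS Cs P t} ∈ H) →
        (∀ Ct : CtxT, {t | semT Ct P t} ∈ H))
    ↔
    -- pfRHSP
    (∀ (P : Prog) (Ct : CtxT) (o : Finset (Pref E)),
        obsLe o {t | semT Ct P t} →
        ∃ Cs : CtxS, obsLe o {t | semS Cs P t}) := by
  constructor
  · intro h P Ct o ho
    by_contra! hno
    refine h {b | ¬ obsLe o b} (fun b hb => ?_) P hno Ct ho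
    exact ⟨o, not_not.mp hb, fun b' hb' => not_not.mpr hb'⟩
  · intro h H hH P hS Ct
    by_contra hT
    obtain ⟨o, ho, hbad⟩ := hH _ hT
    obtain ⟨Cs, hCs⟩ := h P Ct o ho
    exact hbad _ hCs (hS Cs)
end

section
/- (Theorem 3.2) For every K ≥ 1, robust preservation of K-hypersafety does not imply robust preservation of (K+1)-hypersafety: there exists a compilation chain over the concrete trace model (over a suitable nonempty event type) that satisfies RKHSP but does not satisfy R(K+1)HSP. -/
/-- H is K-hypersafety: any behavior outside H has a bad observation of at most
K finite prefixes. -/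
def KHypersafety {E : Type} (K : ℕ) (H : Set (Set (Trc E))) : Prop :=
  ∀ b, b ∉ H → ∃ o : Finset (Pref E), o.card ≤ K ∧ obsLe o b ∧
    ∀ b', obsLe o b' → b' ∉ H

/-- Robust K-Hypersafety Preservation. -/
def RKHSP {E Prog CtxS CtxT : Type} (K : ℕ)
    (semS : CtxS → Prog → Trc E → Prop)
    (semT : CtxT → Prog → Trc E → Prop) : Prop :=
  ∀ (H : Set (Set (Trc E))), KHypersafety K H → ∀ (P : Prog),
    (∀ Cs : CtxS, {t | semS Cs P t} ∈ H) →
    (∀ Ct : CtxT, {t | semT Ct P t} ∈ H)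

/-- If any at most `K` traces of a target behavior all occur in some source behavior of the same
program, then `K`-hypersafety is robustly preserved. -/
theorem rkhsp_of_small_subsets {E Prog CtxS CtxT : Type} {K : ℕ}
    {semS : CtxS → Prog → Trc E → Prop} {semT : CtxT → Prog → Trc E → Prop}
    (h : ∀ P Ct (s : Finset (Trc E)), s.card ≤ K → (∀ t ∈ s, semT Ct P t) →
      ∃ Cs, ∀ t ∈ s, semS Cs P t) :
    RKHSP K semS semT := by
  classical
  intro H hH P hS Ct
  by_contra hb
  obtain ⟨o, hcard, hle, hbad⟩ := hH _ hb
  have : Nonempty (Trc E) := ⟨Trc.term []⟩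
  choose! f hf hpref using hle
  obtain ⟨Cs, hCs⟩ := h P Ct (o.image f) (Finset.card_image_le.trans hcard) (by
    simpa [Finset.forall_mem_image] using hf)
  exact hbad _ (fun m hm => ⟨f m, hCs _ (Finset.mem_image_of_mem f hm), hpref m hm⟩) (hS Cs)

/-- Not exhibiting a given observation `o` is a `K`-hypersafety property for `o.card ≤ K`. -/
theorem kHypersafety_not_obsLe {E : Type} {K : ℕ} (o : Finset (Pref E)) (ho : o.card ≤ K) :
    KHypersafety K {b : Set (Trc E) | ¬ obsLe o b} :=
  fun _ hb => ⟨o, ho, not_not.mp hb, fun _ hb' hn => hn hb'⟩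

/-- Theorem 3.2: for every K ≥ 1, robust preservation of
K-hypersafety does not imply robust preservation of (K+1)-hypersafety. -/
theorem rkhsp_not_implies_rkkhsp :
    ∀ K : ℕ, 1 ≤ K →
      ∃ (E : Type) (_ : Nonempty E) (Prog CtxS CtxT : Type)
        (semS : CtxS → Prog → Trc E → Prop)
        (semT : CtxT → Prog → Trc E → Prop),
        RKHSP K semS semT ∧ ¬ RKHSP (K + 1) semS semT := by
  intro K _
  refine ⟨Fin (K + 1), inferInstance, Unit, Fin (K + 1), Unit,
    fun i _ t => ∃ j, j ≠ i ∧ t = Trc.term [j], fun _ _ t => ∃ j, t = Trc.term [j], ?_, ?_⟩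
  · classical
    refine rkhsp_of_small_subsets fun _ _ s hs hsT => ?_
    choose! g hg using hsT
    obtain ⟨i, hi⟩ : ∃ i, i ∉ s.image g := by
      by_contra! hall
      have hcard : (s.image g).card = K + 1 := by
        rw [Finset.eq_univ_of_forall hall, Finset.card_univ, Fintype.card_fin]
      have := Finset.card_image_le (s := s) (f := g)
      omega
    exact ⟨i, fun t ht =>
      ⟨g t, fun h => hi (h ▸ Finset.mem_image_of_mem g ht), hg t ht⟩⟩
  · intro h
    let e : Fin (K + 1) ↪ Pref (Fin (K + 1)) :=
      ⟨fun i => Pref.complete [i], fun i j hij => by simpa using hij⟩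
    refine h _ (kHypersafety_not_obsLe (Finset.univ.map e) (by simp)) () (fun i hi => ?_) () ?_
    · obtain ⟨t, ⟨j, hj, rfl⟩, hpref⟩ := hi (e i) (Finset.mem_map_of_mem e (Finset.mem_univ i))
      exact hj (List.singleton_injective hpref)
    · intro m hm
      obtain ⟨i, -, rfl⟩ := Finset.mem_map.mp hm
      exact ⟨Trc.term [i], ⟨i, rfl⟩, rfl⟩
end

section
/- Assume the event type E is nonempty. Then for every compilation chain over the concrete trace model, Robust Hyperliveness Preservation (RHLP), i.e., RHP restricted to hyperliveness hyperproperties, holds if and only if RHP (robust preservation of all hyperproperties) holds. In particular, for every set of traces b, the hyperproperty { b' | b' ≠ b } is hyperliveness. -/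
/-- H is hyperliveness: every observation can be extended to a behavior in H. -/
def Hyperliveness {E : Type} (H : Set (Set (Trc E))) : Prop :=
  ∀ o : Finset (Pref E), ∃ b : Set (Trc E), obsLe o b ∧ b ∈ H

theorem obsLe_range_term {E : Type} (o : Finset (Pref E)) : obsLe o (Set.range Trc.term) := by
  rintro (l | l) -
  · exact ⟨Trc.term l, ⟨l, rfl⟩, List.prefix_rfl⟩
  · exact ⟨Trc.term l, ⟨l, rfl⟩, rfl⟩

theorem obsLe_univ {E : Type} (o : Finset (Pref E)) : obsLe o Set.univ := fun m hm =>
  let ⟨t, _, ht⟩ := obsLe_range_term o m hm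
  ⟨t, trivial, ht⟩

theorem range_term_ne_univ {E : Type} [h : Nonempty E] :
    Set.range (Trc.term (E := E)) ≠ Set.univ := by
  obtain ⟨e⟩ := h
  intro h
  obtain ⟨l, hl⟩ := Set.eq_univ_iff_forall.mp h (Trc.inf fun _ => e)
  cases hl

theorem hyperliveness_ne {E : Type} [Nonempty E] (b : Set (Trc E)) :
    Hyperliveness {b' | b' ≠ b} := by
  intro o
  by_cases hb : b = Set.univ
  · exact ⟨_, obsLe_range_term o, hb ▸ range_term_ne_univ⟩
  · exact ⟨_, obsLe_univ o, Ne.symm hb⟩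

/-- for a nonempty event type, RHLP (RHP restricted to
hyperliveness) is equivalent to RHP for every compilation chain; in particular,
for every behavior b the hyperproperty { b' | b' ≠ b } is hyperliveness. -/
theorem rhlp_iff_rhp (E : Type) [Nonempty E] :
    (∀ (Prog CtxS CtxT : Type)
       (semS : CtxS → Prog → Trc E → Prop)
       (semT : CtxT → Prog → Trc E → Prop),
       -- RHLP
       (∀ (H : Set (Set (Trc E))), Hyperliveness H → ∀ (P : Prog),
          (∀ Cs : CtxS, {t | semS Cs P t} ∈ H) →
          (∀ Ct : CtxT, {t | semT Ct P t} ∈ H))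
       ↔
       -- RHP
       (∀ (H : Set (Set (Trc E))) (P : Prog),
          (∀ Cs : CtxS, {t | semS Cs P t} ∈ H) →
          (∀ Ct : CtxT, {t | semT Ct P t} ∈ H)))
    ∧
    (∀ b : Set (Trc E), Hyperliveness {b' | b' ≠ b}) := by
  refine ⟨fun Prog CtxS CtxT semS semT => ⟨fun h H P hS Ct => ?_, fun h H _ => h H⟩,
    hyperliveness_ne⟩
  obtain ⟨Cs, hCs⟩ : ∃ Cs, {t | semS Cs P t} = {t | semT Ct P t} := by
    by_contra! hne
    exact h _ (hyperliveness_ne {t | semT Ct P t}) P hne Ct rfl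
  exact hCs ▸ hS Cs
end

section
/- For every compilation chain, Robust 2-relational Hyperproperty Preservation (R2rHP) holds if and only if its property-free characterization (pfR2rHP) holds, where R2rHP states: for every binary relation R on behaviors (sets of traces) and all source programs P1, P2, if for all source contexts Cs, (behav(Cs[P1]), behav(Cs[P2])) ∈ R, then for all target contexts Ct, (behav(Ct[P1↓]), behav(Ct[P2↓])) ∈ R; and pfR2rHP states: for all source programs P1, P2 and every target context Ct there exists a source context Cs such that behav(Ct[P1↓]) = behav(Cs[P1]) and behav(Ct[P2↓]) = behav(Cs[P2]). -/
/-- R2rHP ↔ pfR2rHP for every compilation chain,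
where behav(C[P]) = { t | C[P] ⇝ t }. -/
theorem r2rhp_iff_pfr2rhp {Prog CtxS CtxT Trace : Type}
    (semS : CtxS → Prog → Trace → Prop)
    (semT : CtxT → Prog → Trace → Prop) :
    -- R2rHP
    (∀ (R : Set (Set Trace × Set Trace)) (P1 P2 : Prog),
        (∀ Cs : CtxS, ({t | semS Cs P1 t}, {t | semS Cs P2 t}) ∈ R) →
        (∀ Ct : CtxT, ({t | semT Ct P1 t}, {t | semT Ct P2 t}) ∈ R))
    ↔
    -- pfR2rHP
    (∀ (P1 P2 : Prog) (Ct : CtxT), ∃ Cs : CtxS,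
        {t | semT Ct P1 t} = {t | semS Cs P1 t} ∧
        {t | semT Ct P2 t} = {t | semS Cs P2 t}) := by
  constructor
  · intro h P1 P2 Ct
    obtain ⟨Cs, hCs⟩ := h
      (Set.range fun Cs => ({t | semS Cs P1 t}, {t | semS Cs P2 t}))
      P1 P2 Set.mem_range_self Ct
    obtain ⟨h1, h2⟩ := Prod.mk.inj hCs
    exact ⟨Cs, h1.symm, h2.symm⟩
  · intro h R P1 P2 hR Ct
    obtain ⟨Cs, h1, h2⟩ := h P1 P2 Ct
    rw [h1, h2]
    exact hR Cs
end

section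
/- For every compilation chain, Robust Relational Hyperproperty Preservation (RrHP) holds if and only if its property-free characterization (pfRrHP) holds, where RrHP states: for every property R of families of behaviors indexed by all source programs, if for all source contexts Cs the family (fun P => behav(Cs[P])) belongs to R, then for all target contexts Ct the family (fun P => behav(Ct[P↓])) belongs to R; and pfRrHP states: for every target context Ct there exists a source context Cs such that for every source program P, behav(Ct[P↓]) = behav(Cs[P]). -/
/-- RrHP ↔ pfRrHP for every compilation chain, where a relational
hyperproperty R is a property of families of behaviors indexed by all source
programs, and behav(C[P]) = { t | C[P] ⇝ t }. -/
theorem rrhp_iff_pfrrhp {Prog CtxS CtxT Trace : Type}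
    (semS : CtxS → Prog → Trace → Prop)
    (semT : CtxT → Prog → Trace → Prop) :
    -- RrHP
    (∀ (R : Set (Prog → Set Trace)),
        (∀ Cs : CtxS, (fun P => {t | semS Cs P t}) ∈ R) →
        (∀ Ct : CtxT, (fun P => {t | semT Ct P t}) ∈ R))
    ↔
    -- pfRrHP
    (∀ Ct : CtxT, ∃ Cs : CtxS, ∀ P : Prog,
        {t | semT Ct P t} = {t | semS Cs P t}) := by
  constructor
  · intro h Ct
    exact h {f | ∃ Cs : CtxS, ∀ P : Prog, f P = {t | semS Cs P t}}
      (fun Cs => ⟨Cs, fun _ => rfl⟩) Ct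
  · intro h R hR Ct
    obtain ⟨Cs, hCs⟩ := h Ct
    rw [funext hCs]
    exact hR Cs
end

section
/- For every compilation chain, Robust 2-relational Trace Property Preservation (R2rTP) holds if and only if its property-free characterization (pfR2rTP) holds, where R2rTP states: for every binary relation R on traces and all source programs P1, P2, if for all source contexts Cs and traces t1, t2, (Cs[P1] ⇝ t1 and Cs[P2] ⇝ t2) implies (t1, t2) ∈ R, then for all target contexts Ct and traces t1, t2, (Ct[P1↓] ⇝ t1 and Ct[P2↓] ⇝ t2) implies (t1, t2) ∈ R; and pfR2rTP states: for all source programs P1, P2, every target context Ct and traces t1, t2, if Ct[P1↓] ⇝ t1 and Ct[P2↓] ⇝ t2, then there exists a source context Cs such that Cs[P1] ⇝ t1 and Cs[P2] ⇝ t2. -/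
/-- R2rTP ↔ pfR2rTP for every compilation chain. -/
theorem r2rtp_iff_pfr2rtp {Prog CtxS CtxT Trace : Type}
    (semS : CtxS → Prog → Trace → Prop)
    (semT : CtxT → Prog → Trace → Prop) :
    -- R2rTP
    (∀ (R : Set (Trace × Trace)) (P1 P2 : Prog),
        (∀ (Cs : CtxS) (t1 t2 : Trace),
            semS Cs P1 t1 → semS Cs P2 t2 → (t1, t2) ∈ R) →
        (∀ (Ct : CtxT) (t1 t2 : Trace),
            semT Ct P1 t1 → semT Ct P2 t2 → (t1, t2) ∈ R))
    ↔
    -- pfR2rTP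
    (∀ (P1 P2 : Prog) (Ct : CtxT) (t1 t2 : Trace),
        semT Ct P1 t1 → semT Ct P2 t2 →
        ∃ Cs : CtxS, semS Cs P1 t1 ∧ semS Cs P2 t2) := by
  constructor
  · intro h P1 P2
    exact h {p | ∃ Cs, semS Cs P1 p.1 ∧ semS Cs P2 p.2} P1 P2
      fun Cs _ _ h1 h2 => ⟨Cs, h1, h2⟩
  · intro h R P1 P2 hR Ct t1 t2 h1 h2
    obtain ⟨Cs, hs1, hs2⟩ := h P1 P2 Ct t1 t2 h1 h2
    exact hR Cs t1 t2 hs1 hs2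
end

section
/- For every compilation chain over the concrete trace model, Robust 2-relational Safety Preservation (R2rSP) holds if and only if its property-free characterization (pfR2rSP) holds, where R2rSP is R2rTP restricted to 2-relational safety relations, and pfR2rSP states: for all source programs P1, P2, every target context Ct and finite prefixes m1, m2, if Ct[P1↓] ⇝ m1 and Ct[P2↓] ⇝ m2, then there exists a source context Cs such that Cs[P1] ⇝ m1 and Cs[P2] ⇝ m2. -/
/-- A binary relation on traces is 2-relational safety. -/
def TwoRelSafety {E : Type} (R : Set (Trc E × Trc E)) : Prop :=
  ∀ t1 t2 : Trc E, (t1, t2) ∉ R →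
    ∃ m1 m2 : Pref E, prefOf m1 t1 ∧ prefOf m2 t2 ∧
      ∀ t1' t2' : Trc E, prefOf m1 t1' → prefOf m2 t2' → (t1', t2') ∉ R

/-- R2rSP ↔ pfR2rSP for every compilation chain over the
concrete trace model, where C[P] ⇝ m means ∃ t ≥ m, C[P] ⇝ t. -/
theorem r2rsp_iff_pfr2rsp {E Prog CtxS CtxT : Type}
    (semS : CtxS → Prog → Trc E → Prop)
    (semT : CtxT → Prog → Trc E → Prop) :
    -- R2rSP
    (∀ (R : Set (Trc E × Trc E)), TwoRelSafety R → ∀ (P1 P2 : Prog),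
        (∀ (Cs : CtxS) (t1 t2 : Trc E),
            semS Cs P1 t1 → semS Cs P2 t2 → (t1, t2) ∈ R) →
        (∀ (Ct : CtxT) (t1 t2 : Trc E),
            semT Ct P1 t1 → semT Ct P2 t2 → (t1, t2) ∈ R))
    ↔
    -- pfR2rSP
    (∀ (P1 P2 : Prog) (Ct : CtxT) (m1 m2 : Pref E),
        (∃ t1 : Trc E, prefOf m1 t1 ∧ semT Ct P1 t1) →
        (∃ t2 : Trc E, prefOf m2 t2 ∧ semT Ct P2 t2) →
        ∃ Cs : CtxS,
          (∃ t1 : Trc E, prefOf m1 t1 ∧ semS Cs P1 t1) ∧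
          (∃ t2 : Trc E, prefOf m2 t2 ∧ semS Cs P2 t2)) := by
  constructor
  · rintro h P1 P2 Ct m1 m2 ⟨t1, hm1, ht1⟩ ⟨t2, hm2, ht2⟩
    by_contra hno
    refine h {p | ¬ (prefOf m1 p.1 ∧ prefOf m2 p.2)} ?_ P1 P2 ?_ Ct t1 t2 ht1 ht2 ⟨hm1, hm2⟩
    · intro u1 u2 hu
      obtain ⟨hu1, hu2⟩ := not_not.mp hu
      exact ⟨m1, m2, hu1, hu2, fun _ _ hv1 hv2 hv => hv ⟨hv1, hv2⟩⟩
    · intro Cs u1 u2 hs1 hs2 hu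
      exact hno ⟨Cs, ⟨u1, hu.1, hs1⟩, ⟨u2, hu.2, hs2⟩⟩
  · intro h R hR P1 P2 hsrc Ct t1 t2 ht1 ht2
    by_contra hnot
    obtain ⟨m1, m2, hm1, hm2, hbad⟩ := hR t1 t2 hnot
    obtain ⟨Cs, ⟨u1, hu1, hs1⟩, ⟨u2, hu2, hs2⟩⟩ :=
      h P1 P2 Ct m1 m2 ⟨t1, hm1, ht1⟩ ⟨t2, hm2, ht2⟩
    exact hbad u1 u2 hu1 hu2 (hsrc Cs u1 u2 hs1 hs2)
end

section
/- (Theorem 4.1) RHP does not imply R2rSP: there exists a compilation chain over the concrete trace model (over a suitable nonempty event type) that satisfies Robust Hyperproperty Preservation (RHP) but does not satisfy Robust 2-relational Safety Preservation (R2rSP). -/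
/-- Robust Hyperproperty Preservation. -/
def RHP {E Prog CtxS CtxT : Type}
    (semS : CtxS → Prog → Trc E → Prop)
    (semT : CtxT → Prog → Trc E → Prop) : Prop :=
  ∀ (H : Set (Set (Trc E))) (P : Prog),
    (∀ Cs : CtxS, {t | semS Cs P t} ∈ H) →
    (∀ Ct : CtxT, {t | semT Ct P t} ∈ H)

/-- Robust 2-relational Safety Preservation. -/
def R2rSP {E Prog CtxS CtxT : Type}
    (semS : CtxS → Prog → Trc E → Prop)
    (semT : CtxT → Prog → Trc E → Prop) : Prop :=
  ∀ (R : Set (Trc E × Trc E)), TwoRelSafety R → ∀ (P1 P2 : Prog),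
    (∀ (Cs : CtxS) (t1 t2 : Trc E),
        semS Cs P1 t1 → semS Cs P2 t2 → (t1, t2) ∈ R) →
    (∀ (Ct : CtxT) (t1 t2 : Trc E),
        semT Ct P1 t1 → semT Ct P2 t2 → (t1, t2) ∈ R)

/-- The terminated trace emitting one event if `b` holds and none otherwise. -/
def bitTrace (b : Bool) : Trc Unit :=
  Trc.term (if b then [()] else [])

/-- Excluding a single pair of terminated traces is 2-relational safety. -/
theorem twoRelSafety_compl_singleton_term {E : Type} (l₁ l₂ : List E) :
    TwoRelSafety {(Trc.term l₁, Trc.term l₂)}ᶜ := by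
  intro t₁ t₂ h
  obtain ⟨rfl, rfl⟩ : t₁ = Trc.term l₁ ∧ t₂ = Trc.term l₂ := by simpa using h
  refine ⟨Pref.complete l₁, Pref.complete l₂, rfl, rfl, ?_⟩
  rintro (l | s) (l' | s') h₁ h₂ <;> simp_all [prefOf]

/-- Theorem 4.1: RHP does not imply R2rSP. -/
theorem rhp_not_implies_r2rsp :
    ∃ (E : Type) (_ : Nonempty E) (Prog CtxS CtxT : Type)
      (semS : CtxS → Prog → Trc E → Prop)
      (semT : CtxT → Prog → Trc E → Prop),
      RHP semS semT ∧ ¬ R2rSP semS semT := by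
  refine ⟨Unit, ⟨()⟩, Bool, Bool, Unit, fun c _ t => t = bitTrace c,
    fun _ p t => t = bitTrace p, fun _ p h _ => h p, fun h => ?_⟩
  refine h _ (twoRelSafety_compl_singleton_term [()] []) true false ?_ () _ _ rfl rfl rfl
  rintro (_ | _) _ _ rfl rfl <;> simp [bitTrace]
end

section
/- (Theorem 4.2, reflection collapse) Suppose the source language can discriminate programs: for every K ≥ 1, every K-tuple of pairwise-distinct source programs P_1, …, P_K, and every K-tuple of source contexts C_1, …, C_K, there exists a source context Cs such that behav(Cs[P_i]) = behav(C_i[P_i]) for each i. Then for every K ≥ 1: RHP implies RKrHP (for every K-ary relation R on behaviors and K-tuple of source programs, if the tuple of behaviors (behav(Cs[P_1]), …, behav(Cs[P_K])) is in R for every source context Cs, then (behav(Ct[P_1↓]), …, behav(Ct[P_K↓])) is in R for every target context Ct), and RSCHP implies RKrTP (for every K-ary relation R on traces and K-tuple of source programs, if for every source context Cs and traces t_1, …, t_K with Cs[P_i] ⇝ t_i for each i one has (t_1, …, t_K) ∈ R, then for every target context Ct and traces t_1, …, t_K with Ct[P_i↓] ⇝ t_i for each i one has (t_1, …, t_K)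 ∈ R). -/
/-- If contexts can be combined over tuples of pairwise-distinct programs, then they can be combined
over arbitrary tuples, provided the context to be matched depends only on the program. -/
theorem exists_context_matching_on_tuple {Prog Ctx Trace : Type}
    {sem : Ctx → Prog → Trace → Prop}
    (hdisc : ∀ (K : ℕ), 1 ≤ K → ∀ (P : Fin K → Prog),
        (∀ i j : Fin K, i ≠ j → P i ≠ P j) →
        ∀ (C : Fin K → Ctx), ∃ Cs : Ctx, ∀ i : Fin K,
          {t | sem Cs (P i) t} = {t | sem (C i) (P i) t})
    {K : ℕ} (hK : 1 ≤ K) (P : Fin K → Prog) (C : Prog → Ctx) :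
    ∃ Cs : Ctx, ∀ i : Fin K, {t | sem Cs (P i) t} = {t | sem (C (P i)) (P i) t} := by
  have : Nonempty (Set.range P) := ⟨⟨P ⟨0, hK⟩, Set.mem_range_self _⟩⟩
  let e := Finite.equivFin (Set.range P)
  obtain ⟨Cs, hCs⟩ := hdisc (Nat.card (Set.range P)) Nat.card_pos (fun n => (e.symm n : Prog))
    (fun _ _ hne heq => hne (e.symm.injective (Subtype.ext heq))) (fun n => C (e.symm n))
  refine ⟨Cs, fun i => ?_⟩
  simpa only [Equiv.symm_apply_apply] using hCs (e ⟨P i, Set.mem_range_self i⟩)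

/-- Theorem 4.2, reflection collapse: if source contexts can
discriminate pairwise-distinct programs (full reflection), then for every
K ≥ 1, RHP implies RKrHP and RSCHP implies RKrTP. -/
theorem reflection_collapse {Prog CtxS CtxT Trace : Type}
    (semS : CtxS → Prog → Trace → Prop)
    (semT : CtxT → Prog → Trace → Prop)
    -- discrimination hypothesis (full reflection)
    (hdisc : ∀ (K : ℕ), 1 ≤ K → ∀ (P : Fin K → Prog),
        (∀ i j : Fin K, i ≠ j → P i ≠ P j) →
        ∀ (C : Fin K → CtxS), ∃ Cs : CtxS, ∀ i : Fin K,
          {t | semS Cs (P i) t} = {t | semS (C i) (P i) t}) :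
    ∀ (K : ℕ), 1 ≤ K →
      -- RHP implies RKrHP
      (((∀ (H : Set (Set Trace)) (P : Prog),
            (∀ Cs : CtxS, {t | semS Cs P t} ∈ H) →
            (∀ Ct : CtxT, {t | semT Ct P t} ∈ H)) →
        (∀ (R : Set (Fin K → Set Trace)) (P : Fin K → Prog),
            (∀ Cs : CtxS, (fun i => {t | semS Cs (P i) t}) ∈ R) →
            (∀ Ct : CtxT, (fun i => {t | semT Ct (P i) t}) ∈ R)))
      ∧
      -- RSCHP implies RKrTP
      ((∀ (H : Set (Set Trace)),
            (∀ b1 b2 : Set Trace, b1 ⊆ b2 → b2 ∈ H → b1 ∈ H) →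
            ∀ (P : Prog),
              (∀ Cs : CtxS, {t | semS Cs P t} ∈ H) →
              (∀ Ct : CtxT, {t | semT Ct P t} ∈ H)) →
        (∀ (R : Set (Fin K → Trace)) (P : Fin K → Prog),
            (∀ (Cs : CtxS) (t : Fin K → Trace),
                (∀ i : Fin K, semS Cs (P i) (t i)) → t ∈ R) →
            (∀ (Ct : CtxT) (t : Fin K → Trace),
                (∀ i : Fin K, semT Ct (P i) (t i)) → t ∈ R)))) := by
  intro K hK
  refine ⟨fun hRHP R P hR Ct => ?_, fun hRSCHP R P hR Ct t ht => ?_⟩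
  · have hback : ∀ Q : Prog, ∃ Cs : CtxS, {t | semT Ct Q t} = {t | semS Cs Q t} := fun Q =>
      hRHP {b | ∃ Cs : CtxS, b = {t | semS Cs Q t}} Q (fun Cs => ⟨Cs, rfl⟩) Ct
    choose C hC using hback
    obtain ⟨Cs, hCs⟩ := exists_context_matching_on_tuple hdisc hK P C
    have heq : (fun i => {t | semT Ct (P i) t}) = fun i => {t | semS Cs (P i) t} :=
      funext fun i => (hC (P i)).trans (hCs i).symm
    exact heq ▸ hR Cs
  · have hback : ∀ Q : Prog, ∃ Cs : CtxS, {t | semT Ct Q t} ⊆ {t | semS Cs Q t} := fun Q =>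
      hRSCHP {b | ∃ Cs : CtxS, b ⊆ {t | semS Cs Q t}}
        (fun _ _ hsub ⟨Cs, hCs⟩ => ⟨Cs, hsub.trans hCs⟩) Q (fun Cs => ⟨Cs, subset_rfl⟩) Ct
    choose C hC using hback
    obtain ⟨Cs, hCs⟩ := exists_context_matching_on_tuple hdisc hK P C
    exact hR Cs t fun i => (hCs i).symm.subset (hC (P i) (ht i))
end

section
/- (Theorem 4.3, nondeterministic-choice collapse) Suppose the source language has an internal nondeterministic choice operator on contexts: a binary operation ⊕ on source contexts such that for all source contexts C1, C2, every source program P, and every trace t, if C1[P] ⇝ t or C2[P] ⇝ t then (C1 ⊕ C2)[P] ⇝ t. Then for every K ≥ 1: RTP implies RKrTP (for every K-ary relation R on traces and K-tuple of source programs P_1, …, P_K, if for every source context Cs and traces t_1, …, t_K with Cs[P_i] ⇝ t_i for each i one has (t_1, …, t_K) ∈ R, then for every target context Ct and traces t_1, …, t_K with Ct[P_i↓] ⇝ t_i for each i one has (t_1, …, t_K) ∈ R); and, over the concrete trace model, RSP implies RKrSP (RKrTP restricted to K-relational safety relations, where a K-ary relation R on traces is K-relational safety iff for every K-tuple of traces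 (t_1, …, t_K) ∉ R there exist finite prefixes m_1 ≤ t_1, …, m_K ≤ t_K such that every K-tuple (t_1', …, t_K') with m_i ≤ t_i' for each i satisfies (t_1', …, t_K') ∉ R). -/
/-- A K-ary relation on traces is K-relational safety. -/
def KRelSafety {E : Type} {K : ℕ} (R : Set (Fin K → Trc E)) : Prop :=
  ∀ t : Fin K → Trc E, t ∉ R →
    ∃ m : Fin K → Pref E, (∀ i, prefOf (m i) (t i)) ∧
      ∀ t' : Fin K → Trc E, (∀ i, prefOf (m i) (t' i)) → t' ∉ R

/-- Under internal nondeterministic choice, any nonempty finite family of contexts has a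
single context exhibiting all of their behaviors. -/
theorem exists_context_of_choice {Ctx Prog T : Type*} (sem : Ctx → Prog → T → Prop)
    (oplus : Ctx → Ctx → Ctx)
    (hoplus : ∀ C1 C2 P t, sem C1 P t ∨ sem C2 P t → sem (oplus C1 C2) P t)
    {n : ℕ} (C : Fin (n + 1) → Ctx) :
    ∃ D, ∀ i P t, sem (C i) P t → sem D P t := by
  induction n with
  | zero => exact ⟨C 0, fun i P t h => by rwa [Fin.fin_one_eq_zero i] at h⟩
  | succ n ih =>
    obtain ⟨D, hD⟩ := ih fun i => C i.succ
    refine ⟨oplus (C 0) D, fun i P t h => hoplus _ _ _ _ ?_⟩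
    cases i using Fin.cases with
    | zero => exact Or.inl h
    | succ j => exact Or.inr (hD j P t h)

/-- Not extending a fixed finite prefix is a safety property. -/
theorem safety_not_prefOf {E : Type} (m : Pref E) : Safety {t | ¬ prefOf m t} :=
  fun _ ht => ⟨m, not_not.mp ht, fun _ ht' => not_not.mpr ht'⟩

/-- Theorem 4.3, nondeterministic-choice collapse: if the source
language has an internal nondeterministic choice operator on contexts, then for
every K ≥ 1, RTP implies RKrTP and RSP implies RKrSP. -/
theorem nondet_choice_collapse {E Prog CtxS CtxT : Type}
    (semS : CtxS → Prog → Trc E → Prop)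
    (semT : CtxT → Prog → Trc E → Prop)
    (oplus : CtxS → CtxS → CtxS)
    (hoplus : ∀ (C1 C2 : CtxS) (P : Prog) (t : Trc E),
        semS C1 P t ∨ semS C2 P t → semS (oplus C1 C2) P t) :
    ∀ (K : ℕ), 1 ≤ K →
      -- RTP implies RKrTP
      (((∀ (π : Set (Trc E)) (P : Prog),
            (∀ (Cs : CtxS) (t : Trc E), semS Cs P t → t ∈ π) →
            (∀ (Ct : CtxT) (t : Trc E), semT Ct P t → t ∈ π)) →
        (∀ (R : Set (Fin K → Trc E)) (P : Fin K → Prog),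
            (∀ (Cs : CtxS) (t : Fin K → Trc E),
                (∀ i, semS Cs (P i) (t i)) → t ∈ R) →
            (∀ (Ct : CtxT) (t : Fin K → Trc E),
                (∀ i, semT Ct (P i) (t i)) → t ∈ R)))
      ∧
      -- RSP implies RKrSP
      ((∀ (π : Set (Trc E)), Safety π → ∀ (P : Prog),
            (∀ (Cs : CtxS) (t : Trc E), semS Cs P t → t ∈ π) →
            (∀ (Ct : CtxT) (t : Trc E), semT Ct P t → t ∈ π)) →
        (∀ (R : Set (Fin K → Trc E)), KRelSafety R → ∀ (P : Fin K → Prog),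
            (∀ (Cs : CtxS) (t : Fin K → Trc E),
                (∀ i, semS Cs (P i) (t i)) → t ∈ R) →
            (∀ (Ct : CtxT) (t : Fin K → Trc E),
                (∀ i, semT Ct (P i) (t i)) → t ∈ R)))) := by
  intro K hK
  obtain ⟨n, rfl⟩ := Nat.exists_eq_add_of_le' hK
  constructor
  · intro hRTP R P hR Ct t ht
    have hsrc : ∀ i, ∃ C, semS C (P i) (t i) := fun i =>
      hRTP {u | ∃ C, semS C (P i) u} (P i) (fun C _ h => ⟨C, h⟩) Ct (t i) (ht i)
    choose C hC using hsrc
    obtain ⟨D, hD⟩ := exists_context_of_choice semS oplus hoplus C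
    exact hR D t fun i => hD i _ _ (hC i)
  · intro hRSP R hsafe P hR Ct t ht
    by_contra htR
    obtain ⟨m, hm, hbad⟩ := hsafe t htR
    have hsrc : ∀ i, ∃ C u, semS C (P i) u ∧ prefOf (m i) u := by
      intro i
      by_contra! hnone
      exact hRSP _ (safety_not_prefOf (m i)) (P i) hnone Ct (t i) (ht i) (hm i)
    choose C u hC hu using hsrc
    obtain ⟨D, hD⟩ := exists_context_of_choice semS oplus hoplus C
    exact hbad u hu (hR D u fun i => hD i _ _ (hC i))
end
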